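/- Let K be an algebraically closed field of odd characteristic, let f ∈ K[X] be an additive polynomial with f'(0) ≠ 0 and deg(f) > 1, set F(X) := X·f(X), and write F = A ∘ X² with A ∈ K[X]. Then the polynomial B(X,Y) := (A(X) − A(Y))/(X − Y) is irreducible in K[X,Y]. -/

import Mathlib

open Polynomial

/-- A polynomial `f ∈ K[X]` is additive if `f(X+Y) = f(X) + f(Y)` holds as an identity
of polynomials in two variables over `K`. -/
def IsAdditive {K : Type*} [CommSemiring K] (f : Polynomial K) : Prop :=
    Polynomial.aeval ((Polynomial.C Polynomial.X + Polynomial.X : Polynomial (Polynomial K))) f =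
      Polynomial.aeval ((Polynomial.C Polynomial.X : Polynomial (Polynomial K))) f +
        Polynomial.aeval ((Polynomial.X : Polynomial (Polynomial K))) f

namespace Polynomial

variable {K : Type*} [Field K]

/-- The ring homomorphism `K[Y][X] → K[z][t]` with `Y ↦ t` and `X ↦ z t`; it turns the total
degree into the degree in `t`. -/
noncomputable def blowup (K : Type*) [Field K] : K[X][X] →+* K[X][X] :=
  eval₂RingHom (mapRingHom (C : K →+* K[X])) (C X * X)

lemma coeff_coeff_blowup (Q : K[X][X]) (n i : ℕ) :
    ((blowup K Q).coeff n).coeff i = if i ≤ n then (Q.coeff i).coeff (n - i) else 0 := by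
  induction Q using Polynomial.induction_on' with
  | add P Q hP hQ =>
    simp only [map_add, coeff_add, hP, hQ]
    split_ifs <;> simp
  | monomial k q =>
    have h : blowup K (monomial k q) = (C (X ^ k) * q.map C) * X ^ k := by
      simp only [blowup, coe_eval₂RingHom, eval₂_monomial, coe_mapRingHom, mul_pow, C_pow]
      ring
    rw [h, coeff_mul_X_pow', coeff_monomial]
    by_cases hk : k ≤ n
    · rw [if_pos hk, coeff_C_mul, coeff_map, mul_comm, coeff_C_mul, coeff_X_pow]
      by_cases hki : i = k
      · subst hki; simp [hk]
      · simp [hki, Ne.symm hki]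
    · by_cases hki : k = i
      · subst hki; simp [hk]
      · simp [hki, hk]

lemma blowup_injective : Function.Injective (blowup K) := by
  intro P Q h
  ext i j
  have h' := congrArg (fun R : K[X][X] => (R.coeff (i + j)).coeff i) h
  simpa [coeff_coeff_blowup] using h'

lemma natDegree_coeff_blowup_le (Q : K[X][X]) (n : ℕ) :
    ((blowup K Q).coeff n).natDegree ≤ n := by
  rw [natDegree_le_iff_coeff_eq_zero]
  intro i hi
  rw [coeff_coeff_blowup, if_neg (by omega)]

lemma isUnit_of_natDegree_blowup_eq_zero {Q : K[X][X]} (hQ : Q ≠ 0)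
    (h : (blowup K Q).natDegree = 0) : IsUnit Q := by
  obtain ⟨c, hc⟩ := natDegree_eq_zero.mp
    (Nat.le_zero.mp (natDegree_coeff_blowup_le Q 0))
  have hQc : Q = C (C c) := by
    apply blowup_injective
    rw [eq_C_of_natDegree_eq_zero h, ← hc]
    simp [blowup]
  have hc0 : c ≠ 0 := by
    rintro rfl
    simp [hQc] at hQ
  rw [hQc]
  exact ((isUnit_iff_ne_zero.mpr hc0).map C).map C

/-- Suppose `Q`, `R` have coprime leading coefficients and that of `R` has degree `R.natDegree`.
If `Q * α + R * β` is constant with `α` of smaller degree than `R`, then `α = 0`. -/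
lemma eq_zero_of_mul_add_mul_eq_C {Q R α β : K[X][X]} {c : K[X]}
    (hQ : 0 < Q.natDegree)
    (hcop : IsCoprime Q.leadingCoeff R.leadingCoeff)
    (hR : R.leadingCoeff.natDegree = R.natDegree)
    (hα : ∀ n, (α.coeff n).natDegree ≤ n) (hαR : α ≠ 0 → α.natDegree < R.natDegree)
    (h : Q * α + R * β = C c) : α = 0 := by
  by_contra hα0
  have hQ0 : Q ≠ 0 := by rintro rfl; simp at hQ
  have hlt := hαR hα0
  have hR0 : R ≠ 0 := by rintro rfl; simp at hlt
  have hdQ : (Q * α).natDegree = Q.natDegree + α.natDegree := natDegree_mul hQ0 hα0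
  have hRβ : R * β = C c - Q * α := by rw [← h]; ring
  have hdR : (R * β).natDegree = (Q * α).natDegree := by
    rw [hRβ]
    exact natDegree_sub_eq_right_of_natDegree_lt (by rw [natDegree_C, hdQ]; omega)
  have hlead : R.leadingCoeff * β.leadingCoeff = - (Q.leadingCoeff * α.leadingCoeff) := by
    rw [← leadingCoeff_mul, ← leadingCoeff_mul, leadingCoeff, hdR, hRβ, coeff_sub, coeff_C,
      if_neg (by omega), zero_sub, leadingCoeff]
  have hdvd : R.leadingCoeff ∣ α.leadingCoeff :=
    hcop.symm.dvd_of_dvd_mul_left ⟨-β.leadingCoeff, by rw [mul_neg, hlead, neg_neg]⟩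
  have := natDegree_le_of_dvd hdvd (leadingCoeff_ne_zero.mpr hα0)
  have := hα α.natDegree
  rw [coeff_natDegree] at this
  omega

/-- The Euler operator `t d/dt`, corrected to annihilate the top-degree term. -/
noncomputable def eulerDefect (R : K[X][X]) : K[X][X] :=
  2 * (X * derivative R - (R.natDegree : K[X][X]) * R)

lemma coeff_eulerDefect (R : K[X][X]) (n : ℕ) :
    (eulerDefect R).coeff n = C (2 * ((n : K) - R.natDegree)) * R.coeff n := by
  have h2 : (2 : K[X][X]) = C 2 := (C_ofNat 2).symm
  rw [eulerDefect, h2, coeff_C_mul, coeff_sub, ← C_eq_natCast, coeff_C_mul]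
  cases n with
  | zero =>
    simp [map_ofNat]
    ring
  | succ n =>
    rw [coeff_X_mul, coeff_derivative]
    simp only [map_mul, map_sub, map_natCast, C_ofNat]
    push_cast
    ring

lemma natDegree_eulerDefect_lt {R : K[X][X]} (h : eulerDefect R ≠ 0) :
    (eulerDefect R).natDegree < R.natDegree := by
  refine lt_of_le_of_ne ?_ fun h' => h ?_
  · refine natDegree_le_iff_coeff_eq_zero.mpr fun n hn => ?_
    rw [coeff_eulerDefect, coeff_eq_zero_of_natDegree_lt hn, mul_zero]
  · rw [← leadingCoeff_eq_zero, leadingCoeff, h', coeff_eulerDefect]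
    simp

lemma natDegree_coeff_eulerDefect_le {R : K[X][X]} (hR : ∀ n, (R.coeff n).natDegree ≤ n) (n : ℕ) :
    ((eulerDefect R).coeff n).natDegree ≤ n := by
  rw [coeff_eulerDefect]
  exact (natDegree_C_mul_le _ _).trans (hR n)

/-- A product satisfying the Euler relation `P + 2 t dP/dt = c`, with separable leading coefficient of
full degree, has no two factors of positive degree. -/
lemma natDegree_eq_zero_or_of_euler {Q R : K[X][X]} {c : K[X]} (hc : c ≠ 0)
    (hQ : ∀ n, (Q.coeff n).natDegree ≤ n) (hR : ∀ n, (R.coeff n).natDegree ≤ n)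
    (heuler : Q * R + 2 * X * derivative (Q * R) = C c)
    (hsep : (Q * R).leadingCoeff.Separable)
    (htop : (Q * R).leadingCoeff.natDegree = (Q * R).natDegree)
    (hdeg : 1 + 2 * ((Q * R).natDegree : K) = 0) :
    Q.natDegree = 0 ∨ R.natDegree = 0 := by
  by_contra! h
  have hQ0 : Q ≠ 0 := by rintro rfl; simp at h
  have hR0 : R ≠ 0 := by rintro rfl; simp at h
  have hdQR := natDegree_mul hQ0 hR0
  rw [leadingCoeff_mul] at hsep htop
  rw [natDegree_mul (leadingCoeff_ne_zero.mpr hQ0) (leadingCoeff_ne_zero.mpr hR0), hdQR] at htop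
  have hlQ : Q.leadingCoeff.natDegree ≤ Q.natDegree := hQ _
  have hlR : R.leadingCoeff.natDegree ≤ R.natDegree := hR _
  have hdeg' : (1 : K[X][X]) + 2 * ((Q.natDegree : K[X][X]) + R.natDegree) = 0 := by
    have := congrArg (fun a : K => (C (C a) : K[X][X])) hdeg
    simpa [hdQR, map_ofNat] using this
  have hrel : Q * eulerDefect R + R * eulerDefect Q = C c := by
    rw [← heuler, derivative_mul, eulerDefect, eulerDefect]
    linear_combination (-(Q * R)) * hdeg'
  have hα : eulerDefect R = 0 :=
    eq_zero_of_mul_add_mul_eq_C (by omega) hsep.isCoprime (by omega)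
      (natDegree_coeff_eulerDefect_le hR) natDegree_eulerDefect_lt hrel
  have hβ : eulerDefect Q = 0 :=
    eq_zero_of_mul_add_mul_eq_C (by omega) hsep.isCoprime.symm (by omega)
      (natDegree_coeff_eulerDefect_le hQ) natDegree_eulerDefect_lt
      (by rw [add_comm]; exact hrel)
  rw [hα, hβ, mul_zero, mul_zero, add_zero, eq_comm, C_eq_zero] at hrel
  exact hc hrel

/-- If `2 X dA/dX - A` is a nonzero multiple of `X`, then `(A(X) - A(Y)) / (X - Y)` is
irreducible. -/
theorem irreducible_of_two_mul_X_mul_derivative_eq {A : K[X]} {a : K} (ha : a ≠ 0)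
    (hA : 2 * X * derivative A = A + C a * X) (hdeg : 2 ≤ A.natDegree) {B : K[X][X]}
    (hB : A.map (C : K →+* K[X]) - C A = (X - C X) * B) : Irreducible B := by
  have hA0 : A ≠ 0 := by rintro rfl; simp at hdeg
  have hN : 2 * (A.natDegree : K) = 1 := by
    have h := congrArg (fun q : K[X] => q.coeff A.natDegree) hA
    obtain ⟨n, hn⟩ : ∃ n, A.natDegree = n + 2 := ⟨A.natDegree - 2, by omega⟩
    have h2 : (2 : K[X]) = C 2 := (C_ofNat 2).symm
    have hl : A.coeff (n + 2) ≠ 0 := by rw [← hn]; exact leadingCoeff_ne_zero.mpr hA0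
    simp only [h2, mul_assoc, coeff_C_mul, hn, coeff_X_mul, coeff_derivative, coeff_add,
      coeff_X] at h
    rw [if_neg (by omega), mul_zero, add_zero] at h
    rw [hn]
    apply mul_left_cancel₀ hl
    push_cast at h ⊢
    linear_combination h
  have hN0 : (A.natDegree : K) ≠ 0 := by
    intro h
    rw [h, mul_zero] at hN
    exact zero_ne_one hN
  set P := blowup K B with hP
  have hW : (C (X - 1) * X) * P = (A.map C).comp (C X * X) - A.map C := by
    have h := congrArg (blowup K) hB
    rw [map_mul, map_sub, map_sub, ← hP] at h
    have h1 : blowup K (A.map C) = (A.map C).comp (C X * X) := by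
      rw [blowup, coe_eval₂RingHom, eval₂_map, comp, eval₂_map]
      congr 1
      ext x
      simp
    have h2 : blowup K (C A) = A.map C := by simp [blowup]
    have h3 : blowup K X = C X * X := by simp [blowup]
    have h4 : blowup K (C X) = X := by simp [blowup]
    rw [h1, h2, h3, h4] at h
    rw [h, C_sub, C_1]
    ring
  have hcoeff (n : ℕ) : (X - 1) * P.coeff n = C (A.coeff (n + 1)) * (X ^ (n + 1) - 1) := by
    have h := congrArg (fun q : K[X][X] => q.coeff (n + 1)) hW
    simp only [mul_assoc, coeff_C_mul, coeff_X_mul, coeff_sub, comp_C_mul_X_coeff,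
      coeff_map] at h
    rw [h]
    ring
  have hX1 : (X - 1 : K[X]) ≠ 0 := X_sub_C_ne_zero (1 : K)
  have hXn (n : ℕ) (hn : n ≠ 0) : (X ^ n - 1 : K[X]) ≠ 0 := X_pow_sub_C_ne_zero (by omega) (1 : K)
  have hPdeg : P.natDegree = A.natDegree - 1 := by
    refine natDegree_eq_of_le_of_coeff_ne_zero ?_ ?_
    · refine natDegree_le_iff_coeff_eq_zero.mpr fun n hn => ?_
      have := hcoeff n
      rw [coeff_eq_zero_of_natDegree_lt (p := A) (by omega), C_0, zero_mul] at this
      exact (mul_eq_zero.mp this).resolve_left hX1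
    · intro h
      have := hcoeff (A.natDegree - 1)
      rw [h, mul_zero, Nat.sub_add_cancel (by omega), eq_comm, mul_eq_zero, C_eq_zero] at this
      exact this.elim (leadingCoeff_ne_zero.mpr hA0) (hXn _ (by omega))
  have hlead : (X - 1) * P.leadingCoeff = C A.leadingCoeff * (X ^ A.natDegree - 1) := by
    have := hcoeff (A.natDegree - 1)
    rwa [Nat.sub_add_cancel (by omega), ← hPdeg] at this
  have hP0 : P ≠ 0 := by
    intro h
    rw [h, natDegree_zero] at hPdeg
    omega
  have hsep : P.leadingCoeff.Separable := by
    have : (C A.leadingCoeff * (X ^ A.natDegree - 1)).Separable :=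
      (X_pow_sub_one_separable_iff.mpr hN0).unit_mul
        ((isUnit_iff_ne_zero.mpr (leadingCoeff_ne_zero.mpr hA0)).map C)
    rw [← hlead] at this
    exact this.of_mul_right
  have htop : P.leadingCoeff.natDegree = P.natDegree := by
    have h := congrArg natDegree hlead
    have e1 : (X - 1 : K[X]).natDegree = 1 := natDegree_X_sub_C (1 : K)
    have e2 : (X ^ A.natDegree - 1 : K[X]).natDegree = A.natDegree :=
      natDegree_X_pow_sub_C (r := (1 : K))
    rw [natDegree_mul hX1 (leadingCoeff_ne_zero.mpr hP0),
      natDegree_C_mul (leadingCoeff_ne_zero.mpr hA0), e1, e2] at h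
    omega
  have hPN : 1 + 2 * (P.natDegree : K) = 0 := by
    rw [hPdeg, Nat.cast_sub (by omega)]
    linear_combination hN
  have heuler : P + 2 * X * derivative P = C (C a) := by
    ext1 n
    apply mul_left_cancel₀ hX1
    have hAn : (2 * (n + 1) : K) * A.coeff (n + 1) = A.coeff (n + 1) + if n = 0 then a else 0 := by
      have h := congrArg (fun q : K[X] => q.coeff (n + 1)) hA
      have h2 : (2 : K[X]) = C 2 := (C_ofNat 2).symm
      simp only [h2, mul_assoc, coeff_C_mul, coeff_X_mul, coeff_derivative, coeff_add,
        coeff_X] at h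
      rcases n with _ | n <;> simp at h ⊢ <;> linear_combination h
    have hPn : (P + 2 * X * derivative P).coeff n = C (2 * (n + 1) - 1 : K) * P.coeff n := by
      have h2 : (2 : K[X][X]) = C 2 := (C_ofNat 2).symm
      rw [coeff_add, h2, mul_assoc, coeff_C_mul]
      cases n with
      | zero =>
        simp [map_ofNat]
        ring
      | succ n =>
        rw [coeff_X_mul, coeff_derivative]
        simp only [map_mul, map_sub, map_add, map_natCast, C_ofNat, C_1]
        push_cast
        ring
    have hAn' : C (2 * (n + 1) - 1 : K) * C (A.coeff (n + 1)) = C (if n = 0 then a else 0) := by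
      rw [← C_mul]
      congr 1
      linear_combination hAn
    rw [hPn, mul_left_comm, hcoeff, ← mul_assoc, hAn', coeff_C]
    split_ifs with hn
    · subst hn; ring
    · simp
  refine ⟨fun hu => ?_, fun Q R hQR => ?_⟩
  · have := natDegree_eq_zero_of_isUnit (hu.map (blowup K))
    rw [← hP] at this
    omega
  · have hPQR : P = blowup K Q * blowup K R := by rw [hP, hQR, map_mul]
    have hB0 : B ≠ 0 := by
      rintro rfl
      exact hP0 (by rw [hP, map_zero])
    rw [hQR] at hB0
    rw [hPQR] at heuler hsep htop hPN
    exact (natDegree_eq_zero_or_of_euler (C_ne_zero.mpr ha) (natDegree_coeff_blowup_le Q)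
      (natDegree_coeff_blowup_le R) heuler hsep htop hPN).imp
      (isUnit_of_natDegree_blowup_eq_zero (left_ne_zero_of_mul hB0))
      (isUnit_of_natDegree_blowup_eq_zero (right_ne_zero_of_mul hB0))

end Polynomial

lemma IsAdditive.derivative_eq_C {K : Type*} [Field K] [Infinite K] {f : K[X]}
    (hf : IsAdditive f) : derivative f = C (eval 0 (derivative f)) := by
  refine Polynomial.funext fun x => ?_
  have hC : (mapRingHom (evalRingHom x)).comp (algebraMap K K[X][X]) = C := by
    ext a
    simp [Polynomial.algebraMap_apply]
  have h := congrArg (mapRingHom (evalRingHom x)) hf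
  simp only [aeval_def, hom_eval₂, map_add, hC] at h
  have hcomp : f.comp (C x + X) = f.comp (C x) + f.comp X := by simpa [comp] using h
  simpa [derivative_comp] using congrArg (fun q : K[X] => eval 0 (derivative q)) hcomp

/-- Let `F := X·f(X)` with `f` additive, `f'(0) ≠ 0`, `deg f > 1`, over an algebraically
closed field of odd characteristic, and write `F = A ∘ X²`.  Then the polynomial
`B(X,Y) = (A(X) - A(Y))/(X - Y)` is irreducible in `K[X,Y]`.  We realize `K[X,Y]` as
`K[Y][X]`, so `A(X) = A.map C`, `A(Y) = C A`, and `X - Y = X - C X`. -/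
theorem statement13 {K : Type*} [Field K] [IsAlgClosed K] (p : ℕ) [CharP K p] (hp : Odd p)
    (f : K[X]) (hf : IsAdditive f) (hf0 : eval 0 (derivative f) ≠ 0)
    (hdeg : 1 < f.natDegree)
    (A : K[X]) (hA : X * f = A.comp (X ^ 2))
    (B : Polynomial (Polynomial K))
    (hB : A.map (C : K →+* K[X]) - C A = (X - C X) * B) :
    Irreducible B := by
  have hf' := hf.derivative_eq_C
  refine irreducible_of_two_mul_X_mul_derivative_eq hf0 ?_ ?_ hB
  · apply expand_injective (R := K) (n := 2) two_pos
    have hd := congrArg derivative hA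
    rw [derivative_mul, derivative_X, one_mul, derivative_comp, derivative_X_pow, hf'] at hd
    simp only [map_mul, map_add, expand_X, expand_C, map_ofNat]
    simp only [expand_eq_comp_X_pow, ← hA]
    norm_num [map_ofNat] at hd
    linear_combination (-X) * hd
  · have hf0' : f ≠ 0 := by rintro rfl; simp at hdeg
    have h := congrArg natDegree hA
    rw [natDegree_comp, natDegree_X_pow, natDegree_mul X_ne_zero hf0', natDegree_X] at h
    omega
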